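/- Let f be a random p-biased function on 𝒳. For every ε ≥ 0, every probability mass function 𝒟* on 𝒳, every φ : 𝒳 → [0,1], and every permutation π : 𝒳 → 𝒳 with no fixed points, with probability at least 1 − 6·exp(−2ε² / (9‖𝒟*‖₂²)) over the randomness of f, it holds that |Σ_{x∈𝒳} 𝒟*(x)φ(x)f(x)f(π(x)) − p²·Σ_{x∈𝒳} 𝒟*(x)φ(x)| ≤ ε. -/

import Mathlib

open Finset Real
open scoped Classical BigOperators

noncomputable section

/-- The real value of a boolean function at a point: `1` if `true`, `0` if `false`. -/
def bval {X : Type} (f : X → Bool) (x : X) : ℝ := if f x then 1 else 0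

/-- The probability weight of a particular function `f : X → Bool` when each value
`f x` is an independent Bernoulli(p) random variable. -/
def bweight {X : Type} [Fintype X] (p : ℝ) (f : X → Bool) : ℝ :=
  ∏ x, if f x then p else 1 - p

/-- The probability of an event `P` under a random `p`-biased function. -/
def bprob (X : Type) [Fintype X] (p : ℝ) (P : (X → Bool) → Prop) : ℝ :=
  ∑ f : X → Bool, bweight p f * (if P f then 1 else 0)

/-- The squared 2-norm of a weight function. -/
def norm2sq {X : Type} [Fintype X] (w : X → ℝ) : ℝ := ∑ x, w x ^ 2

theorem aux_hoeff (p : ℝ) (hp0 : 0 ≤ p) (hp1 : p ≤ 1) (a b c : ℝ) (h : |a - b| ≤ c) :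
    p * exp a + (1 - p) * exp b ≤ exp (p * a + (1 - p) * b + c ^ 2 / 8) := by
  let μ : MeasureTheory.Measure Bool :=
    ENNReal.ofReal p • MeasureTheory.Measure.dirac true
      + ENNReal.ofReal (1 - p) • MeasureTheory.Measure.dirac false
  have hq : 0 ≤ 1 - p := by linarith
  have hμ : MeasureTheory.IsProbabilityMeasure μ := by
    constructor
    simp only [μ, MeasureTheory.Measure.add_apply, MeasureTheory.Measure.smul_apply,
      MeasureTheory.measure_univ, smul_eq_mul, mul_one]
    rw [← ENNReal.ofReal_add hp0 hq]
    simp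
  have hint : ∀ F : Bool → ℝ, ∫ x, F x ∂μ = p * F true + (1 - p) * F false := by
    intro F
    have i1 : MeasureTheory.IsFiniteMeasure (ENNReal.ofReal p • MeasureTheory.Measure.dirac true) :=
      MeasureTheory.Measure.smul_finite _ ENNReal.ofReal_ne_top
    have i2 : MeasureTheory.IsFiniteMeasure
        (ENNReal.ofReal (1 - p) • MeasureTheory.Measure.dirac false) :=
      MeasureTheory.Measure.smul_finite _ ENNReal.ofReal_ne_top
    rw [MeasureTheory.integral_add_measure (.of_finite) (.of_finite),
      MeasureTheory.integral_smul_measure, MeasureTheory.integral_smul_measure]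
    simp [ENNReal.toReal_ofReal, hp0, hq]
  let Y : Bool → ℝ := fun x => if x then a else b
  have H := ProbabilityTheory.hasSubgaussianMGF_of_mem_Icc (μ := μ) (X := Y)
    (a := min a b) (b := max a b) (measurable_of_finite _).aemeasurable
    (Filter.Eventually.of_forall (by intro x; cases x <;> simp [Y]))
  have H1 := H.mgf_le 1
  rw [ProbabilityTheory.mgf, hint, hint] at H1
  simp only [Y, if_true, one_mul] at H1
  simp only [Bool.false_eq_true, if_false] at H1
  have e1 : ((((‖max a b - min a b‖₊ / 2) ^ 2 : NNReal) : ℝ)) = |a - b| ^ 2 / 4 := by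
    push_cast
    rw [max_sub_min_eq_abs]
    simp only [Real.norm_eq_abs, abs_abs, abs_sub_comm b a]
    ring
  rw [e1] at H1
  set m := p * a + (1 - p) * b
  have e2 : exp a = exp m * exp (a - m) := by rw [← exp_add]; ring_nf
  have e3 : exp b = exp m * exp (b - m) := by rw [← exp_add]; ring_nf
  calc p * exp a + (1 - p) * exp b = exp m * (p * exp (a - m) + (1 - p) * exp (b - m)) := by
        rw [e2, e3]; ring
    _ ≤ exp m * exp (|a - b| ^ 2 / 4 * 1 ^ 2 / 2) := by gcongr
    _ ≤ exp (m + c ^ 2 / 8) := by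
        rw [← exp_add]
        apply exp_le_exp.2
        have : |a - b| ^ 2 ≤ c ^ 2 := by gcongr
        linarith

theorem aux_sum_succ (n : ℕ) (F : (Fin (n + 1) → Bool) → ℝ) (p : ℝ) :
    ∑ f, bweight p f * F f = p * (∑ f : Fin n → Bool, bweight p f * F (Fin.cons true f))
      + (1 - p) * (∑ f : Fin n → Bool, bweight p f * F (Fin.cons false f)) := by
  rw [← (Fin.consEquiv (fun _ : Fin (n + 1) => Bool)).sum_comp, Fintype.sum_prod_type]
  simp only [Fintype.sum_bool, Fin.consEquiv_apply, bweight, Fin.prod_univ_succ, Fin.cons_zero,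
    Fin.cons_succ, Finset.mul_sum]
  simp [mul_assoc]
  rfl

theorem aux_bweight_nonneg {X : Type} [Fintype X] (p : ℝ) (hp0 : 0 ≤ p) (hp1 : p ≤ 1)
    (f : X → Bool) : 0 ≤ bweight p f := by
  apply Finset.prod_nonneg
  intro x _
  split_ifs <;> linarith

theorem aux_sum_prod {X : Type} [Fintype X] (h : X → Bool → ℝ) :
    ∑ f : X → Bool, ∏ x, h x (f x) = ∏ x, (h x true + h x false) := by
  have := (Fintype.prod_sum (fun x b => h x b)).symm
  simpa [Fintype.sum_bool] using this

theorem aux_bweight_sum {X : Type} [Fintype X] (p : ℝ) :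
    ∑ f : X → Bool, bweight p f = 1 := by
  unfold bweight
  rw [aux_sum_prod (fun _ b => if b then p else 1 - p)]
  simp

theorem aux_mcd_fin (p : ℝ) (hp0 : 0 ≤ p) (hp1 : p ≤ 1) (n : ℕ) :
    ∀ (g : (Fin n → Bool) → ℝ) (c : Fin n → ℝ),
      (∀ f f' x, (∀ y, y ≠ x → f y = f' y) → |g f - g f'| ≤ c x) →
      ∑ f, bweight p f * exp (g f) ≤ exp (∑ f, bweight p f * g f + (∑ x, c x ^ 2) / 8) := by
  induction n with
  | zero => intro g c _; simp [bweight]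
  | succ n ih =>
    intro g c h
    rw [aux_sum_succ, aux_sum_succ]
    have hb : ∀ b : Bool, ∑ f : Fin n → Bool, bweight p f * exp (g (Fin.cons b f)) ≤
        exp (∑ f : Fin n → Bool, bweight p f * g (Fin.cons b f)
          + (∑ x : Fin n, c x.succ ^ 2) / 8) := by
      intro b
      apply ih (fun f => g (Fin.cons b f)) (fun x => c x.succ)
      intro f f' x hx
      apply h
      intro y
      refine Fin.cases ?_ ?_ y
      · simp
      · intro z hz
        simpa using hx z (fun e => hz (by rw [e]))
    set m1 := ∑ f : Fin n → Bool, bweight p f * g (Fin.cons true f)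
    set m0 := ∑ f : Fin n → Bool, bweight p f * g (Fin.cons false f)
    have hm : |m1 - m0| ≤ c 0 := by
      have : m1 - m0 = ∑ f : Fin n → Bool,
          bweight p f * (g (Fin.cons true f) - g (Fin.cons false f)) := by
        simp only [m1, m0, ← Finset.sum_sub_distrib, mul_sub]
      rw [this]
      calc _ ≤ ∑ f : Fin n → Bool,
          |bweight p f * (g (Fin.cons true f) - g (Fin.cons false f))| :=
            Finset.abs_sum_le_sum_abs _ _
        _ ≤ ∑ f : Fin n → Bool, bweight p f * c 0 := by
            apply Finset.sum_le_sum
            intro f _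
            rw [abs_mul, abs_of_nonneg (aux_bweight_nonneg p hp0 hp1 f)]
            apply mul_le_mul_of_nonneg_left _ (aux_bweight_nonneg p hp0 hp1 f)
            apply h
            intro y
            refine Fin.cases ?_ ?_ y
            · simp
            · simp
        _ = c 0 := by
            have hs : ∑ f : Fin n → Bool, bweight p f = 1 := by
              convert aux_bweight_sum (X := Fin n) p
            rw [← Finset.sum_mul, hs, one_mul]
    have hq : 0 ≤ 1 - p := by linarith
    refine (add_le_add (mul_le_mul_of_nonneg_left (hb true) hp0)
      (mul_le_mul_of_nonneg_left (hb false) hq)).trans ?_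
    refine (aux_hoeff p hp0 hp1 _ _ (c 0) (by simpa using hm)).trans ?_
    apply exp_le_exp.2
    rw [Fin.sum_univ_succ]
    apply le_of_eq
    ring

theorem aux_mcd {X : Type} [Fintype X] (p : ℝ) (hp0 : 0 ≤ p) (hp1 : p ≤ 1)
    (g : (X → Bool) → ℝ) (c : X → ℝ)
    (h : ∀ f f' x, (∀ y, y ≠ x → f y = f' y) → |g f - g f'| ≤ c x) :
    ∑ f, bweight p f * exp (g f) ≤ exp (∑ f, bweight p f * g f + (∑ x, c x ^ 2) / 8) := by
  let e := Fintype.equivFin X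
  have hsum : ∀ F : (X → Bool) → ℝ, ∑ f, bweight p f * F f =
      ∑ f : Fin (Fintype.card X) → Bool, bweight p f * F (f ∘ e) := by
    intro F
    rw [← (Equiv.arrowCongr e.symm (Equiv.refl Bool)).sum_comp]
    apply Finset.sum_congr rfl
    intro f _
    have h1 : (Equiv.arrowCongr e.symm (Equiv.refl Bool)) f = f ∘ e := by ext x; simp
    rw [h1]
    congr 1
    exact e.prod_comp (fun i => if f i then p else 1 - p)
  rw [hsum, hsum, ← e.symm.sum_comp]
  apply aux_mcd_fin p hp0 hp1 _ (fun f => g (f ∘ e)) (fun i => c (e.symm i))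
  intro f f' x hx
  apply h
  intro y hy
  apply hx
  intro he
  exact hy (by rw [← he]; simp)

theorem aux_pair {X : Type} [Fintype X] (p : ℝ) (x y : X) (hxy : x ≠ y) :
    ∑ f : X → Bool, bweight p f * (bval f x * bval f y) = p ^ 2 := by
  have h1 : ∀ f : X → Bool, bweight p f * (bval f x * bval f y) =
      ∏ z, (fun z (b : Bool) => (if b then p else 1 - p) *
        ((if z = x then (if b then (1:ℝ) else 0) else 1) *
          (if z = y then (if b then (1:ℝ) else 0) else 1))) z (f z) := by
    intro f
    simp only [Finset.prod_mul_distrib, Finset.prod_ite_eq', Finset.mem_univ, if_true, bweight,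
      bval]
  rw [Finset.sum_congr rfl (fun f _ => h1 f)]
  refine (aux_sum_prod (fun z (b : Bool) => (if b then p else 1 - p) *
        ((if z = x then (if b then (1:ℝ) else 0) else 1) *
          (if z = y then (if b then (1:ℝ) else 0) else 1)))).trans ?_
  have h2 : ∀ z : X, ((if true then p else 1 - p) *
        ((if z = x then (if true then (1:ℝ) else 0) else 1) *
          (if z = y then (if true then (1:ℝ) else 0) else 1))) +
      ((if false then p else 1 - p) *
        ((if z = x then (if false then (1:ℝ) else 0) else 1) *
          (if z = y then (if false then (1:ℝ) else 0) else 1)))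
      = (if z = x then p else 1) * (if z = y then p else 1) := by
    intro z
    by_cases hx : z = x
    · have : z ≠ y := fun h => hxy (hx ▸ h)
      simp [hx, hxy]
    · by_cases hy : z = y <;> simp [hx, hy]
      intro h; exact absurd h.symm hxy
  have h3 := Finset.prod_congr (rfl : (Finset.univ : Finset X) = _) (fun z _ => h2 z)
  refine Eq.trans ?_ (h3.trans ?_)
  · rfl
  · rw [Finset.prod_mul_distrib]
    simp [sq]

theorem aux_bval {X : Type} (f : X → Bool) (x : X) : 0 ≤ bval f x ∧ bval f x ≤ 1 := by
  unfold bval; split_ifs <;> norm_num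

/-- One-sided tail. -/
theorem aux_tail {X : Type} [Fintype X] (p : ℝ) (hp0 : 0 ≤ p) (hp1 : p ≤ 1)
    (ε : ℝ) (hε : 0 ≤ ε) (g : (X → Bool) → ℝ) (c : X → ℝ) (N : ℝ) (hN : 0 < N)
    (h : ∀ f f' x, (∀ y, y ≠ x → f y = f' y) → |g f - g f'| ≤ c x)
    (hc : ∑ x, c x ^ 2 ≤ 4 * N) (hmean : ∑ f, bweight p f * g f = 0)
    (s : ℝ) (hs : |s| = 1) :
    ∑ f, bweight p f * (if ε < s * g f then 1 else 0) ≤ exp (-(2 * ε ^ 2) / (9 * N)) := by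
  have hs2 : s ^ 2 = 1 := by rw [← sq_abs, hs]; norm_num
  set t := ε / N with ht
  have ht0 : 0 ≤ t := by positivity
  have M := aux_mcd p hp0 hp1 (fun f => t * (s * g f)) (fun x => t * c x) (by
    intro f f' x hx
    have : t * (s * g f) - t * (s * g f') = t * (s * (g f - g f')) := by ring
    simp only [this, abs_mul, hs, one_mul, abs_of_nonneg ht0]
    exact mul_le_mul_of_nonneg_left (h f f' x hx) ht0)
  have hm : ∑ f, bweight p f * (t * (s * g f)) = 0 := by
    have : ∀ f : X → Bool, bweight p f * (t * (s * g f)) = t * s * (bweight p f * g f) := by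
      intro f; ring
    simp only [this, ← Finset.mul_sum, hmean, mul_zero]
  have hc2 : ∑ x, (t * c x) ^ 2 = t ^ 2 * ∑ x, c x ^ 2 := by
    simp only [mul_pow, ← Finset.mul_sum]
  rw [hm, hc2, zero_add] at M
  calc ∑ f, bweight p f * (if ε < s * g f then 1 else 0)
      ≤ ∑ f, exp (-(t * ε)) * (bweight p f * exp (t * (s * g f))) := by
        apply Finset.sum_le_sum
        intro f _
        have hw := aux_bweight_nonneg p hp0 hp1 f
        have : (if ε < s * g f then (1:ℝ) else 0) ≤ exp (-(t * ε)) * exp (t * (s * g f)) := by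
          rw [← exp_add]
          split_ifs with hh
          · apply one_le_exp
            nlinarith
          · positivity
        calc _ ≤ bweight p f * (exp (-(t * ε)) * exp (t * (s * g f))) :=
              mul_le_mul_of_nonneg_left this hw
          _ = _ := by ring
    _ = exp (-(t * ε)) * ∑ f, bweight p f * exp (t * (s * g f)) := by rw [Finset.mul_sum]
    _ ≤ exp (-(t * ε)) * exp (t ^ 2 * (∑ x, c x ^ 2) / 8) := by gcongr
    _ ≤ exp (-(2 * ε ^ 2) / (9 * N)) := by
        rw [← exp_add]
        apply exp_le_exp.2
        have h1 : t ^ 2 * (∑ x, c x ^ 2) ≤ t ^ 2 * (4 * N) := by gcongr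
        have h2 : t ^ 2 * (4 * N) = 4 * (ε ^ 2 / N) := by rw [ht]; field_simp
        have h3 : t * ε = ε ^ 2 / N := by rw [ht]; field_simp
        have h4 : -(2 * ε ^ 2) / (9 * N) = -(2 / 9) * (ε ^ 2 / N) := by field_simp
        have h5 : 0 ≤ ε ^ 2 / N := by positivity
        rw [h3, h4]
        linarith

theorem stmt5 {X : Type} [Fintype X] (p : ℝ) (hp0 : 0 ≤ p) (hp1 : p ≤ 1)
    (ε : ℝ) (hε : 0 ≤ ε) (Ds φ : X → ℝ)
    (hDs0 : ∀ x, 0 ≤ Ds x) (hDs1 : ∀ x, Ds x ≤ 1) (hDssum : ∑ x, Ds x = 1)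
    (hφ0 : ∀ x, 0 ≤ φ x) (hφ1 : ∀ x, φ x ≤ 1)
    (σ : Equiv.Perm X) (hσ : ∀ x, σ x ≠ x) :
    bprob X p (fun f =>
        |(∑ x, Ds x * φ x * bval f x * bval f (σ x)) - p ^ 2 * ∑ x, Ds x * φ x| ≤ ε) ≥
      1 - 6 * Real.exp (-(2 * ε ^ 2) / (9 * norm2sq Ds)) := by
  set N := norm2sq Ds with hNdef
  have hN : 0 < N := by
    have h0 : 0 ≤ N := Finset.sum_nonneg (fun x _ => sq_nonneg _)
    rcases h0.lt_or_eq with h | h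
    · exact h
    · exfalso
      have h1 := (Finset.sum_eq_zero_iff_of_nonneg (fun x _ => sq_nonneg (Ds x))).1 h.symm
      have h2 : ∑ x, Ds x = 0 := Finset.sum_eq_zero (fun x hx => by simpa using h1 x hx)
      linarith
  set g : (X → Bool) → ℝ := fun f =>
    (∑ x, Ds x * φ x * bval f x * bval f (σ x)) - p ^ 2 * ∑ x, Ds x * φ x with hg
  have hmean : ∑ f, bweight p f * g f = 0 := by
    simp only [hg, mul_sub, Finset.sum_sub_distrib, ← Finset.sum_mul, aux_bweight_sum, one_mul]
    rw [sub_eq_zero]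
    simp only [Finset.mul_sum]
    rw [Finset.sum_comm]
    apply Finset.sum_congr rfl
    intro x _
    rw [← aux_pair p x (σ x) (hσ x).symm, Finset.sum_mul]
    apply Finset.sum_congr rfl
    intro f _
    ring
  set c : X → ℝ := fun x => Ds x + Ds (σ.symm x) with hcdef
  have hc : ∑ x, c x ^ 2 ≤ 4 * N := by
    have h1 : ∑ x, Ds (σ.symm x) ^ 2 = N := σ.symm.sum_comp (fun x => Ds x ^ 2)
    have h2 : ∑ x, Ds x ^ 2 = N := rfl
    calc ∑ x, c x ^ 2 ≤ ∑ x, (2 * Ds x ^ 2 + 2 * Ds (σ.symm x) ^ 2) := by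
          apply Finset.sum_le_sum
          intro x _
          simp only [hcdef]
          nlinarith [sq_nonneg (Ds x - Ds (σ.symm x))]
      _ = 4 * N := by
          rw [Finset.sum_add_distrib, ← Finset.mul_sum, ← Finset.mul_sum, h1, h2]; ring
  have hbd : ∀ f f' x, (∀ y, y ≠ x → f y = f' y) → |g f - g f'| ≤ c x := by
    intro f f' x hx
    have h1 : g f - g f' = ∑ z, Ds z * φ z *
        (bval f z * bval f (σ z) - bval f' z * bval f' (σ z)) := by
      simp only [hg, sub_sub_sub_cancel_right, ← Finset.sum_sub_distrib]
      apply Finset.sum_congr rfl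
      intro z _
      ring
    rw [h1]
    calc _ ≤ ∑ z, |Ds z * φ z * (bval f z * bval f (σ z) - bval f' z * bval f' (σ z))| :=
          Finset.abs_sum_le_sum_abs _ _
      _ ≤ ∑ z, ((if z = x then Ds z else 0) + (if z = σ.symm x then Ds z else 0)) := by
          apply Finset.sum_le_sum
          intro z _
          have hD := hDs0 z
          have hle : |Ds z * φ z * (bval f z * bval f (σ z) - bval f' z * bval f' (σ z))|
              ≤ Ds z := by
            obtain ⟨a0, a1⟩ := aux_bval f z
            obtain ⟨b0, b1⟩ := aux_bval f (σ z)
            obtain ⟨a0', a1'⟩ := aux_bval f' z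
            obtain ⟨b0', b1'⟩ := aux_bval f' (σ z)
            have k : |bval f z * bval f (σ z) - bval f' z * bval f' (σ z)| ≤ 1 := by
              rw [abs_le]
              constructor <;> nlinarith [mul_nonneg a0 b0, mul_nonneg a0' b0',
                mul_le_one₀ a1 b0 b1, mul_le_one₀ a1' b0' b1']
            rw [abs_mul, abs_of_nonneg (mul_nonneg hD (hφ0 z)), mul_assoc]
            exact mul_le_of_le_one_right hD (mul_le_one₀ (hφ1 z) (abs_nonneg _) k)
          by_cases e1 : z = x
          · rw [if_pos e1]
            split_ifs <;> linarith
          · by_cases e2 : z = σ.symm x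
            · rw [if_neg e1, if_pos e2]
              linarith
            · have e3 : σ z ≠ x := fun e => e2 (by rw [← e]; simp)
              have k1 : bval f z = bval f' z := by simp only [bval, hx z e1]
              have k2 : bval f (σ z) = bval f' (σ z) := by simp only [bval, hx (σ z) e3]
              rw [if_neg e1, if_neg e2, k1, k2]
              simp
      _ = c x := by
          simp [Finset.sum_add_distrib, hcdef]
  have T1 := aux_tail p hp0 hp1 ε hε g c N hN hbd hc hmean 1 (by simp)
  have T2 := aux_tail p hp0 hp1 ε hε g c N hN hbd hc hmean (-1) (by simp)
  have key : (1 : ℝ) ≤ bprob X p (fun f => |g f| ≤ ε)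
      + ∑ f, bweight p f * (if ε < 1 * g f then 1 else 0)
      + ∑ f, bweight p f * (if ε < (-1) * g f then 1 else 0) := by
    unfold bprob
    refine (aux_bweight_sum (X := X) p).symm.le.trans ?_
    rw [← Finset.sum_add_distrib, ← Finset.sum_add_distrib]
    apply Finset.sum_le_sum
    intro f _
    have hw := aux_bweight_nonneg p hp0 hp1 f
    rw [← mul_add, ← mul_add]
    apply le_mul_of_one_le_right hw
    by_cases q1 : ε < 1 * g f
    · rw [if_pos q1]
      split_ifs <;> norm_num
    · by_cases q2 : ε < (-1) * g f
      · rw [if_pos q2]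
        split_ifs <;> norm_num
      · have : |g f| ≤ ε := abs_le.2 ⟨by linarith, by linarith⟩
        rw [if_pos this]
        split_ifs <;> norm_num
  have hpos := exp_pos (-(2 * ε ^ 2) / (9 * N))
  have key2 : 1 - 6 * Real.exp (-(2 * ε ^ 2) / (9 * N)) ≤ bprob X p (fun f => |g f| ≤ ε) := by
    linarith
  exact key2

end
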